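/- arXiv:2012.04814 — 3 statements merged into one kernel-verified Lean document; each statement's English description precedes it below -/
import Mathlib

section
/- Let T > 0 and let (Ω, 𝓕, (𝓕_t)_{t∈[0,T]}, P) be a filtered probability space. Let Δ : [0,T] × Ω → ℝ be progressively measurable with E[∫₀^T Δ_s² ds] < ∞. If for every 0 ≤ t ≤ t+δ ≤ T one has E[∫_t^{t+δ} Δ_s ds | 𝓕_t] ≤ 0 almost surely, then Δ_s(ω) ≤ 0 for (Lebesgue ⊗ P)-almost every (s,ω) ∈ [0,T] × Ω. -/
open MeasureTheory Set
open Filter Topology Function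

/-- A function with nonpositive integrals over all intervals to the right of `r` is a.e. nonpositive
there. -/
theorem ae_nonpos_of_intervalIntegral_nonpos {G : ℝ → ℝ} (hG : LocallyIntegrable G) (r : ℝ)
    (h : ∀ a b, r ≤ a → a ≤ b → ∫ s in a..b, G s ≤ 0) : ∀ᵐ s, r < s → G s ≤ 0 := by
  filter_upwards [_root_.LocallyIntegrable.ae_hasDerivAt_integral hG] with s hs hrs
  refine le_of_tendsto (hasDerivAt_iff_tendsto_slope_left_right.1 (hs s)).2 ?_
  filter_upwards [self_mem_nhdsWithin] with x (hx : s < x)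
  simpa [slope_def_field] using
    div_nonpos_of_nonpos_of_nonneg (h s x hrs.le hx.le) (sub_nonneg.2 hx.le)

/-- Lebesgue differentiation along the backward averages over `(s - 1 / (n + 1), s]`. -/
theorem tendsto_backward_average {B : ℝ → ℝ} (hB : LocallyIntegrable B) :
    ∀ᵐ s, Tendsto (fun n : ℕ => ((n : ℝ) + 1) * ∫ r in Ioc (s - 1 / ((n : ℝ) + 1)) s, B r) atTop
      (𝓝 (B s)) := by
  filter_upwards [_root_.LocallyIntegrable.ae_hasDerivAt_integral hB] with s hs
  have h0 : Tendsto (fun n : ℕ => s - 1 / ((n : ℝ) + 1)) atTop (𝓝[<] s) := by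
    refine tendsto_nhdsWithin_iff.2 ⟨?_, Eventually.of_forall fun n => ?_⟩
    · simpa using tendsto_one_div_add_atTop_nhds_zero_nat.const_sub s
    · exact sub_lt_self s Nat.one_div_pos_of_nat
  refine ((hasDerivAt_iff_tendsto_slope_left_right.1 (hs s)).1.comp h0).congr fun n => ?_
  have hn : s - 1 / ((n : ℝ) + 1) ≤ s := sub_le_self s Nat.one_div_pos_of_nat.le
  simp only [comp_apply, slope_def_field, intervalIntegral.integral_same, sub_zero,
    intervalIntegral.integral_of_ge hn, sub_sub_cancel_left]
  field_simp

open Measure in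
/-- If each event `{0 < D r}` makes the later time integrals of `D` nonpositive in mean, then `D ≤ 0`
a.e.: for a.e. `s` the backward time averages of the indicators of `{0 < D r}` converge to the
indicator of `{0 < D s}`, so the positive part of `D s` has nonpositive mean. -/
theorem ae_nonpos_of_setIntegral_intervalIntegral_nonpos {Ω : Type*} [MeasurableSpace Ω]
    {P : Measure Ω} [IsFiniteMeasure P] {D : ℝ → Ω → ℝ} (hD : Measurable (uncurry D))
    (hint : Integrable (uncurry D) (volume.prod P))
    (h : ∀ r a b, r ≤ a → a ≤ b → ∫ ω in {ω | 0 < D r ω}, (∫ s in a..b, D s ω) ∂P ≤ 0) :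
    ∀ᵐ p ∂(volume.prod P), D p.1 p.2 ≤ 0 := by
  set B : ℝ → Ω → ℝ := fun r ω => if 0 < D r ω then 1 else 0 with hBdef
  have hDm (s) : Measurable (D s) := hD.of_uncurry_left
  have hB : Measurable (uncurry B) :=
    Measurable.ite (measurableSet_lt measurable_const hD) measurable_const measurable_const
  have hB1 (r ω) : ‖B r ω‖ ≤ 1 := by simp only [hBdef]; split_ifs <;> simp
  have hBm (ω) : Measurable fun r => B r ω := hB.of_uncurry_right
  have hBint (ω) : LocallyIntegrable fun r => B r ω :=
    (locallyIntegrable_const (1 : ℝ)).mono (hBm ω).aestronglyMeasurable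
      (Eventually.of_forall fun r => by simpa using hB1 r ω)
  have hH (r s) : ∫ ω, B r ω * D s ω ∂P = ∫ ω in {ω | 0 < D r ω}, D s ω ∂P := by
    rw [← integral_indicator (measurableSet_lt measurable_const (hDm r))]
    congr 1 with ω
    simp [hBdef, indicator_apply]
  have slice_nonpos (r : ℝ) : ∀ᵐ s, r < s → ∫ ω, B r ω * D s ω ∂P ≤ 0 := by
    simp_rw [hH]
    have hint' : Integrable (uncurry D) (volume.prod (P.restrict {ω | 0 < D r ω})) :=
      hint.mono_measure (Measure.prod_mono le_rfl Measure.restrict_le_self)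
    refine ae_nonpos_of_intervalIntegral_nonpos hint'.integral_prod_left.locallyIntegrable r
      fun a b hra hab => ?_
    refine le_of_eq_of_le ?_ (h r a b hra hab)
    simp_rw [intervalIntegral.integral_of_le hab]
    exact integral_integral_swap
      (hint'.mono_measure (Measure.prod_mono Measure.restrict_le_self le_rfl))
  have hHm : Measurable fun q : ℝ × ℝ => ∫ ω, B q.1 ω * D q.2 ω ∂P := by
    refine (StronglyMeasurable.integral_prod_right (f := fun (q : ℝ × ℝ) ω => B q.1 ω * D q.2 ω)
      (Measurable.stronglyMeasurable ?_)).measurable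
    exact (hB.comp (by fun_prop : Measurable fun p : (ℝ × ℝ) × Ω => (p.1.1, p.2))).mul
      (hD.comp (by fun_prop : Measurable fun p : (ℝ × ℝ) × Ω => (p.1.2, p.2)))
  have swapped_slice_nonpos : ∀ᵐ s : ℝ, ∀ᵐ r : ℝ, r < s → ∫ ω, B r ω * D s ω ∂P ≤ 0 := by
    refine (ae_ae_comm ?_).1 (Eventually.of_forall slice_nonpos)
    simp only [imp_iff_not_or, ofPred_or]
    exact (measurableSet_lt measurable_fst measurable_snd).compl.union
      (measurableSet_le hHm measurable_const)
  set F : ℕ → ℝ → Ω → ℝ := fun n s ω =>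
    ((n : ℝ) + 1) * ∫ r in Ioc (s - 1 / ((n : ℝ) + 1)) s, B r ω with hF
  have hFm (n) : Measurable (uncurry (F n)) := by
    refine Measurable.const_mul ?_ _
    have e : (fun p : ℝ × Ω => ∫ r in Ioc (p.1 - 1 / ((n : ℝ) + 1)) p.1, B r p.2) =
        fun p : ℝ × Ω => ∫ r, if r ∈ Ioc (p.1 - 1 / ((n : ℝ) + 1)) p.1 then B r p.2 else 0 := by
      ext p
      simp [← integral_indicator measurableSet_Ioc, indicator_apply]
    simp_rw [e]
    refine (StronglyMeasurable.integral_prod_right (f := fun (p : ℝ × Ω) (r : ℝ) =>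
      if r ∈ Ioc (p.1 - 1 / ((n : ℝ) + 1)) p.1 then B r p.2 else 0)
      (Measurable.stronglyMeasurable ?_)).measurable
    refine Measurable.ite ?_
      (hB.comp (by fun_prop : Measurable fun p : (ℝ × Ω) × ℝ => (p.2, p.1.2))) measurable_const
    simp only [mem_Ioc, ofPred_and]
    exact (measurableSet_lt (by fun_prop) (by fun_prop)).inter
      (measurableSet_le (by fun_prop) (by fun_prop))
  have hF1 (n s ω) : ‖F n s ω‖ ≤ 1 := by
    have hn : (0 : ℝ) < (n : ℝ) + 1 := by positivity
    have := norm_setIntegral_le_of_norm_le_const (μ := volume) (f := fun r => B r ω)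
      (s := Ioc (s - 1 / ((n : ℝ) + 1)) s) (C := 1) (by simp) (fun r _ => hB1 r ω)
    simp only [hF, norm_mul, Real.norm_of_nonneg hn.le]
    calc _ ≤ ((n : ℝ) + 1) * (1 / ((n : ℝ) + 1)) := by
          gcongr
          simpa [measureReal_def, hn.le] using this
      _ = 1 := by field_simp
  have ae_tendsto_F : ∀ᵐ s : ℝ, ∀ᵐ ω ∂P, Tendsto (fun n => F n s ω) atTop (𝓝 (B s ω)) := by
    refine (ae_ae_comm (p := fun ω s => Tendsto (fun n => F n s ω) atTop (𝓝 (B s ω))) ?_).1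
      (Eventually.of_forall fun ω => tendsto_backward_average (hBint ω))
    exact measurableSet_tendsto_fun (fun n => (hFm n).comp measurable_swap)
      (hB.comp measurable_swap)
  refine (ae_prod_iff_ae_ae (p := fun p : ℝ × Ω => D p.1 p.2 ≤ 0)
    (measurableSet_le hD measurable_const)).2 ?_
  filter_upwards [swapped_slice_nonpos, ae_tendsto_F, hint.prod_right_ae] with s hs2 hs3 hs
  change Integrable (D s) P at hs
  have hlim : Tendsto (fun n => ∫ ω, F n s ω * D s ω ∂P) atTop (𝓝 (∫ ω, B s ω * D s ω ∂P)) := by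
    refine tendsto_integral_of_dominated_convergence (fun ω => ‖D s ω‖)
      (fun n => ((hFm n).of_uncurry_left.mul (hDm s)).aestronglyMeasurable) hs.norm
      (fun n => Eventually.of_forall fun ω => ?_) ?_
    · rw [norm_mul]
      exact mul_le_of_le_one_left (norm_nonneg _) (hF1 n s ω)
    · filter_upwards [hs3] with ω hω using hω.mul_const _
  have hneg (n) : ∫ ω, F n s ω * D s ω ∂P ≤ 0 := by
    simp_rw [hF, mul_assoc, integral_const_mul, ← integral_mul_const]
    refine mul_nonpos_of_nonneg_of_nonpos (by positivity) ?_
    rw [integral_integral_swap]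
    · refine integral_nonpos_of_ae ?_
      rw [EventuallyLE, ← restrict_Ioo_eq_restrict_Ioc, ae_restrict_iff' measurableSet_Ioo]
      filter_upwards [hs2] with r hr hrs using hr hrs.2
    · have hsnd : Integrable (fun p : Ω × ℝ => D s p.1)
          (P.prod (volume.restrict (Ioc (s - 1 / ((n : ℝ) + 1)) s))) := hs.comp_fst _
      exact hsnd.bdd_mul (hB.comp measurable_swap).aestronglyMeasurable
        (Eventually.of_forall fun p => hB1 p.2 p.1)
  have hle : ∫ ω, B s ω * D s ω ∂P ≤ 0 := le_of_tendsto hlim (Eventually.of_forall hneg)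
  have hnn (ω) : 0 ≤ B s ω * D s ω := by
    simp only [hBdef]; split_ifs with hpos <;> simp [le_of_lt, *]
  have hi : Integrable (fun ω => B s ω * D s ω) P :=
    hs.bdd_mul hB.of_uncurry_left.aestronglyMeasurable (Eventually.of_forall (hB1 s))
  filter_upwards [(integral_eq_zero_iff_of_nonneg hnn hi).1 (hle.antisymm (integral_nonneg hnn))]
    with ω hω
  by_contra! hpos
  simp [hBdef, hpos, hpos.ne'] at hω

/-- A progressively measurable process is jointly measurable on `[a, T] × Ω`. -/
theorem MeasureTheory.IsStronglyProgressive.measurable_ite_mem_Icc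
    {Ω : Type*} {m : MeasurableSpace Ω}
    {ℱ : Filtration ℝ m} {Δ : ℝ → Ω → ℝ} (h : IsStronglyProgressive ℱ Δ) (a T : ℝ) :
    Measurable (uncurry fun s ω => if s ∈ Icc a T then Δ s ω else 0) := by
  let g : ℝ × Ω → Iic T × Ω := fun p => (⟨min p.1 T, mem_Iic.2 (min_le_right _ _)⟩, p.2)
  have hg : @Measurable _ _ _ (Subtype.instMeasurableSpace.prod (ℱ T)) g :=
    @Measurable.prodMk _ _ _ _ _ (ℱ T) (fun p => (g p).1) (fun p => (g p).2)
      (Measurable.subtype_mk (measurable_fst.min measurable_const))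
      (measurable_snd.mono le_rfl (ℱ.le T))
  have hm := @Measurable.comp _ _ _ _ (Subtype.instMeasurableSpace.prod (ℱ T)) _ _ _
    (h T).measurable hg
  have e : (uncurry fun s ω => if s ∈ Icc a T then Δ s ω else 0) =
      fun p : ℝ × Ω => if p.1 ∈ Icc a T then ((fun q : Iic T × Ω => Δ q.1 q.2) ∘ g) p else 0 := by
    ext ⟨s, ω⟩
    by_cases hs : s ∈ Icc a T
    · simp [g, hs.2]
    · simp only [uncurry_apply_pair, hs, if_false]
  rw [e]
  exact Measurable.ite (measurableSet_Icc.preimage measurable_fst) hm measurable_const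

/-- Localization step: if `E[∫_t^{t+δ} Δ_s ds | 𝓕_t] ≤ 0` a.s. for every subinterval
`[t, t+δ]` of `[0,T]`, then `Δ ≤ 0` for (Lebesgue ⊗ P)-a.e. `(s, ω) ∈ [0,T] × Ω`. -/
theorem stmt1
    {Ω : Type*} {m : MeasurableSpace Ω} (P : Measure Ω) [IsProbabilityMeasure P]
    (T : ℝ) (hT : 0 < T) (ℱ : Filtration ℝ m)
    (Δ : ℝ → Ω → ℝ) (hΔprog : ProgMeasurable ℱ Δ)
    (hΔint : ∫⁻ ω, (∫⁻ s in Icc (0 : ℝ) T, ENNReal.ofReal ((Δ s ω) ^ 2)) ∂P < ⊤)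
    (h : ∀ t δ : ℝ, 0 ≤ t → 0 ≤ δ → t + δ ≤ T →
      ∀ᵐ ω ∂P, (P[fun ω' => ∫ s in t..(t + δ), Δ s ω'|ℱ t]) ω ≤ 0) :
    ∀ᵐ p ∂((volume.restrict (Icc (0 : ℝ) T)).prod P), Δ p.1 p.2 ≤ 0 := by
  set D : ℝ → Ω → ℝ := fun s ω => if s ∈ Icc 0 T then Δ s ω else 0 with hDdef
  have hD : Measurable (uncurry D) := IsStronglyProgressive.measurable_ite_mem_Icc hΔprog 0 T
  have hDΔ {s} (hs : s ∈ Icc 0 T) (ω) : D s ω = Δ s ω := by simp only [hDdef, if_pos hs]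
  have hD0 {s} (hs : s ∉ Icc 0 T) (ω) : D s ω = 0 := by simp only [hDdef, if_neg hs]
  have hrestr : (volume.restrict (Icc (0 : ℝ) T)).prod P =
      (volume.prod P).restrict (Icc 0 T ×ˢ univ) := by
    rw [← Measure.prod_restrict, Measure.restrict_univ]
  have hsq : Integrable (fun p => uncurry D p ^ 2) ((volume.restrict (Icc (0 : ℝ) T)).prod P) := by
    refine ⟨(hD.pow_const 2).aestronglyMeasurable, ?_⟩
    rw [hasFiniteIntegral_iff_ofReal (Eventually.of_forall fun p => sq_nonneg _),
      lintegral_prod_symm' _ (hD.pow_const 2).ennreal_ofReal]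
    refine lt_of_eq_of_lt
      (lintegral_congr fun ω => setLIntegral_congr_fun measurableSet_Icc ?_) hΔint
    intro s hs
    simp [hDΔ hs]
  have hint : Integrable (uncurry D) (volume.prod P) := by
    have hμ : Integrable (uncurry D) ((volume.restrict (Icc (0 : ℝ) T)).prod P) :=
      ((memLp_two_iff_integrable_sq hD.aestronglyMeasurable).2 hsq).integrable one_le_two
    rw [hrestr] at hμ
    refine IntegrableOn.integrable_of_forall_notMem_eq_zero hμ ?_
    rintro ⟨s, ω⟩ hs
    exact hD0 (fun h => hs ⟨h, trivial⟩) ω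
  have key : ∀ᵐ p ∂(volume.prod P), D p.1 p.2 ≤ 0 := by
    refine ae_nonpos_of_setIntegral_intervalIntegral_nonpos hD hint fun r a b hra hab => ?_
    by_cases hr : r ∈ Icc 0 T
    swap
    · simp [hD0 hr]
    rcases le_or_gt T a with haT | haT
    · refine (integral_eq_zero_of_ae (Eventually.of_forall fun ω => ?_)).le
      refine intervalIntegral.integral_zero_ae (Eventually.of_forall fun s hs => hD0 ?_ ω)
      rw [uIoc_of_le hab] at hs
      exact fun h => (haT.trans_lt hs.1).not_ge h.2
    have hac : a ≤ min b T := le_min hab haT.le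
    have h0a : 0 ≤ a := hr.1.trans hra
    have e (ω) : ∫ s in a..b, D s ω = ∫ s in a..min b T, Δ s ω := by
      rw [intervalIntegral.integral_of_le hab, intervalIntegral.integral_of_le hac]
      have : Ioc a (min b T) ⊆ Ioc a b := Ioc_subset_Ioc_right (min_le_left _ _)
      rw [setIntegral_eq_of_subset_of_forall_sdiff_eq_zero measurableSet_Ioc this]
      · refine setIntegral_congr_fun measurableSet_Ioc fun s hs => ?_
        exact hDΔ ⟨h0a.trans hs.1.le, hs.2.trans (min_le_right _ _)⟩ ω
      · exact fun s hs => hD0 (fun h => hs.2 ⟨hs.1.1, le_min hs.1.2 h.2⟩) ω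
    have hI : Integrable (fun ω => ∫ s in a..b, D s ω) P := by
      simp_rw [intervalIntegral.integral_of_le hab]
      exact (hint.mono_measure
        (Measure.prod_mono Measure.restrict_le_self le_rfl)).integral_prod_right
    have hA : MeasurableSet[ℱ a] {ω | 0 < D r ω} := by
      simp_rw [hDΔ hr]
      exact ℱ.mono hra _
        (measurableSet_lt measurable_const (IsStronglyProgressive.stronglyAdapted hΔprog r).measurable)
    have hcond := h a (min b T - a) h0a (sub_nonneg.2 hac) (by simp)
    simp only [add_sub_cancel, ← e] at hcond
    rw [← setIntegral_condExp (ℱ.le a) hI hA]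
    exact setIntegral_nonpos_of_ae hcond
  rw [hrestr]
  filter_upwards [ae_restrict_of_ae key,
    ae_restrict_mem (measurableSet_Icc.prod MeasurableSet.univ)] with p hp hps
  rwa [hDΔ hps.1] at hp
end

section
/- Let T > 0, let (Ω, 𝓕, P) be a probability space, and let Δ : [0,T] × Ω → ℝ be measurable with E[∫₀^T |Δ_s| ds] < ∞ and Δ_s(ω) ≤ 0 for (Lebesgue ⊗ P)-almost every (s,ω) ∈ [0,T] × Ω; extend Δ by Δ_s := 0 for s > T. With the one-sided mollifiers ζ_n defined below, set Δ_n(s,ω) := ∫₀^∞ ζ_n(u) Δ_{s+u}(ω) du. If liminf_{n→∞} E[Δ_n(s)] ≥ 0 for Lebesgue-almost every s ∈ [0,T], then Δ_s(ω) = 0 for (Lebesgue ⊗ P)-almost every (s,ω) ∈ [0,T] × Ω. -/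
open MeasureTheory Set Filter

/-- One-sided mollifications of an integrable function by a bounded kernel supported in `[0, 1]`
converge to the function at almost every point. -/
theorem ae_tendsto_integral_mollifier {ζ h : ℝ → ℝ} {c : ℝ} (hh : Integrable h)
    (hζm : Measurable ζ) (hζb : ∀ t, |ζ t| ≤ c) (hζs : ∀ t, 1 ≤ t → ζ t = 0)
    (hζint : ∫ t in Ioi (0 : ℝ), ζ t = 1) :
    ∀ᵐ x, Tendsto (fun n : ℕ => ∫ u in Ioi (0 : ℝ), ((n : ℝ) * ζ (n * u)) * h (x + u)) atTop
      (nhds (h x)) := by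
  filter_upwards [(IsUnifLocDoublingMeasure.vitaliFamily (volume : Measure ℝ)
    1).ae_tendsto_average_norm_sub hh.locallyIntegrable] with x hx
  have hlim : Tendsto (fun n : ℕ => x + (n : ℝ)⁻¹) atTop (nhdsWithin x (Ioi x)) := by
    refine tendsto_nhdsWithin_iff.2 ⟨?_, ?_⟩
    · simpa using (tendsto_inv_atTop_nhds_zero_nat (𝕜 := ℝ)).const_add x
    · filter_upwards [eventually_gt_atTop 0] with n hn
      simpa using hn
  have hav := ((hx.comp (Real.tendsto_Icc_vitaliFamily_right x)).comp hlim).const_mul c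
  rw [mul_zero] at hav
  rw [tendsto_iff_norm_sub_tendsto_zero]
  refine squeeze_zero' (Eventually.of_forall fun n => norm_nonneg _) ?_ hav
  filter_upwards [eventually_gt_atTop 0] with n hn
  have hn' : (0 : ℝ) < n := by exact_mod_cast hn
  have hsupp : ∀ u : ℝ, (n : ℝ)⁻¹ < u → ζ (n * u) = 0 := fun u hu => by
    refine hζs _ ?_
    rw [inv_lt_iff_one_lt_mul₀ hn'] at hu
    linarith
  have hone : ∫ u in Ioi (0 : ℝ), (n : ℝ) * ζ (n * u) = 1 := by
    rw [integral_const_mul, integral_comp_mul_left_Ioi _ _ hn', mul_zero, hζint]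
    simp [hn'.ne']
  have hKint : IntegrableOn (fun u : ℝ => (n : ℝ) * ζ (n * u)) (Ioi 0) := by
    by_contra hK
    rw [integral_undef hK] at hone
    exact zero_ne_one hone
  have hhx : Integrable (fun u : ℝ => h (x + u)) := hh.comp_add_left x
  have hKm : Measurable (fun u : ℝ => (n : ℝ) * ζ (n * u)) := by fun_prop
  have hKb : ∀ u : ℝ, ‖(n : ℝ) * ζ (n * u)‖ ≤ n * c := fun u => by
    rw [norm_mul, Real.norm_natCast]
    exact mul_le_mul_of_nonneg_left (hζb _) hn'.le
  have hprod : IntegrableOn (fun u : ℝ => ((n : ℝ) * ζ (n * u)) * h (x + u)) (Ioi 0) :=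
    (hhx.bdd_mul hKm.aestronglyMeasurable (Eventually.of_forall hKb)).integrableOn
  have hdiff : (∫ u in Ioi (0 : ℝ), ((n : ℝ) * ζ (n * u)) * h (x + u)) - h x =
      ∫ u in Ioc (0 : ℝ) (n : ℝ)⁻¹, ((n : ℝ) * ζ (n * u)) * (h (x + u) - h x) := by
    calc _ = (∫ u in Ioi (0 : ℝ), ((n : ℝ) * ζ (n * u)) * h (x + u)) -
          ∫ u in Ioi (0 : ℝ), ((n : ℝ) * ζ (n * u)) * h x := by
          rw [integral_mul_const, hone, one_mul]
      _ = ∫ u in Ioi (0 : ℝ), ((n : ℝ) * ζ (n * u)) * (h (x + u) - h x) := by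
          rw [← integral_sub hprod (hKint.mul_const _)]
          simp only [mul_sub]
      _ = _ := by
          refine setIntegral_eq_of_subset_of_forall_sdiff_eq_zero measurableSet_Ioi
            Ioc_subset_Ioi_self fun u hu => ?_
          rw [hsupp u (by
            by_contra! hle
            exact hu.2 ⟨hu.1, hle⟩)]
          simp
  rw [hdiff]
  have hloc : IntegrableOn (fun u : ℝ => h (x + u) - h x) (Ioc 0 (n : ℝ)⁻¹) :=
    hhx.integrableOn.sub (by simp)
  have hshift : ∫ u in Ioc (0 : ℝ) (n : ℝ)⁻¹, ‖h (x + u) - h x‖ =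
      ∫ y in Icc x (x + (n : ℝ)⁻¹), ‖h y - h x‖ := by
    rw [integral_Icc_eq_integral_Ioc, ← intervalIntegral.integral_of_le (by positivity),
      ← intervalIntegral.integral_of_le (by simp),
      intervalIntegral.integral_comp_add_left (fun y => ‖h y - h x‖), add_zero]
  calc _ ≤ ∫ u in Ioc (0 : ℝ) (n : ℝ)⁻¹, (n * c) * ‖h (x + u) - h x‖ := by
        refine norm_integral_le_of_norm_le (hloc.norm.const_mul _) (Eventually.of_forall fun u => ?_)
        rw [norm_mul]
        exact mul_le_mul_of_nonneg_right (hKb u) (norm_nonneg _)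
    _ = _ := by
        rw [integral_const_mul, hshift]
        simp [setAverage_eq, Measure.real]
        ring

/-- Sandwich step: a nonpositive integrable process whose one-sided mollifications have
nonnegative liminf expectation for a.e. time must vanish (Lebesgue ⊗ P)-a.e. -/
theorem stmt5
    {Ω : Type*} {m : MeasurableSpace Ω} (P : Measure Ω) [IsProbabilityMeasure P]
    (T : ℝ) (hT : 0 < T)
    (Δ : ℝ → Ω → ℝ) (hΔmeas : Measurable (Function.uncurry Δ))
    (hΔint : ∫⁻ ω, (∫⁻ s in Icc (0 : ℝ) T, ENNReal.ofReal |Δ s ω|) ∂P < ⊤)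
    (hΔnonpos : ∀ᵐ p ∂((volume.restrict (Icc (0 : ℝ) T)).prod P), Δ p.1 p.2 ≤ 0)
    (hΔzero : ∀ s : ℝ, T < s → ∀ ω, Δ s ω = 0)
    (c : ℝ) (hc : 0 < c)
    (ζ : ℝ → ℝ)
    (hζ : ∀ t : ℝ, ζ t = if 0 ≤ t ∧ t < 1 then c * Real.exp (-1 / (1 - t ^ 2)) else 0)
    (hζint : ∫ t in Ioi (0 : ℝ), ζ t = 1)
    (ζn : ℕ → ℝ → ℝ) (hζn : ∀ n t, ζn n t = (n : ℝ) * ζ ((n : ℝ) * t))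
    (Δn : ℕ → ℝ → Ω → ℝ)
    (hΔn : ∀ n s ω, Δn n s ω = ∫ u in Ioi (0 : ℝ), ζn n u * Δ (s + u) ω)
    (hliminf : ∀ᵐ s ∂(volume.restrict (Icc (0 : ℝ) T)),
      0 ≤ liminf (fun n => ∫ ω, Δn n s ω ∂P) atTop) :
    ∀ᵐ p ∂((volume.restrict (Icc (0 : ℝ) T)).prod P), Δ p.1 p.2 = 0 := by
  have hζm : Measurable ζ := by
    rw [funext hζ]
    exact Measurable.ite measurableSet_Ico (by fun_prop) measurable_const
  have hζb : ∀ t, |ζ t| ≤ c := fun t => by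
    rw [hζ]
    split_ifs with ht
    · rw [abs_of_pos (by positivity)]
      refine mul_le_of_le_one_right hc.le (Real.exp_le_one_iff.2 ?_)
      exact div_nonpos_of_nonpos_of_nonneg (by norm_num) (by nlinarith)
    · simpa using hc.le
  have hζs : ∀ t, 1 ≤ t → ζ t = 0 := fun t ht => by
    rw [hζ, if_neg fun h => absurd h.2 ht.not_gt]
  have hΔi : Integrable (Function.uncurry Δ) ((volume.restrict (Icc (0 : ℝ) T)).prod P) := by
    refine ⟨hΔmeas.aestronglyMeasurable, ?_⟩
    rw [hasFiniteIntegral_iff_norm, lintegral_prod_symm' _ (by fun_prop)]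
    exact hΔint
  set F : ℝ × Ω → ℝ := (Icc (0 : ℝ) T ×ˢ univ).indicator (Function.uncurry Δ) with hF
  have hFi : Integrable F (volume.prod P) := by
    rw [hF, integrable_indicator_iff (measurableSet_Icc.prod MeasurableSet.univ), IntegrableOn,
      ← Measure.prod_restrict, Measure.restrict_univ]
    exact hΔi
  have hFΔ : ∀ s, 0 ≤ s → ∀ ω, F (s, ω) = Δ s ω := fun s hs ω => by
    by_cases hsT : s ≤ T
    · simp [hF, hs, hsT]
    · simp [hF, hsT, hΔzero s (not_le.1 hsT) ω]
  have hkey : ∀ s, 0 ≤ s → ∀ n, ∫ ω, Δn n s ω ∂P =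
      ∫ u in Ioi (0 : ℝ), ((n : ℝ) * ζ (n * u)) * ∫ ω, F (s + u, ω) ∂P := by
    intro s hs n
    have hint : Integrable (fun p : ℝ × Ω => ((n : ℝ) * ζ (n * p.1)) * F (s + p.1, p.2))
        ((volume.restrict (Ioi (0 : ℝ))).prod P) := by
      have hshift : Integrable (fun p : ℝ × Ω => F (s + p.1, p.2)) (volume.prod P) :=
        ((measurePreserving_add_left volume s).prod
          (MeasurePreserving.id P)).integrable_comp_of_integrable hFi
      refine Integrable.bdd_mul (c := n * c) ?_
        (Measurable.aestronglyMeasurable (by fun_prop)) (Eventually.of_forall fun p => ?_)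
      · exact hshift.mono_measure (Measure.prod_mono Measure.restrict_le_self le_rfl)
      · rw [norm_mul, Real.norm_natCast]
        exact mul_le_mul_of_nonneg_left (hζb _) n.cast_nonneg
    have hswap := integral_integral_swap
      (f := fun (u : ℝ) (ω : Ω) => ((n : ℝ) * ζ (n * u)) * F (s + u, ω)) hint
    simp only [integral_const_mul] at hswap
    rw [hswap]
    refine integral_congr_ae (Eventually.of_forall fun ω => ?_)
    simp only [hΔn, hζn]
    refine setIntegral_congr_fun measurableSet_Ioi fun u hu => ?_
    simp only [hFΔ (s + u) (add_nonneg hs (le_of_lt hu)) ω]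
  have hmean : ∀ᵐ s ∂(volume.restrict (Icc (0 : ℝ) T)), 0 ≤ ∫ ω, Δ s ω ∂P := by
    filter_upwards [hliminf, ae_restrict_mem measurableSet_Icc, ae_restrict_of_ae
      (ae_tendsto_integral_mollifier hFi.integral_prod_left hζm hζb hζs hζint)] with s hs hsI hlim
    simp only [hkey s hsI.1] at hs
    rw [hlim.liminf_eq] at hs
    simpa only [hFΔ s hsI.1] using hs
  have hneg : 0 ≤ᵐ[(volume.restrict (Icc (0 : ℝ) T)).prod P]
      fun p => -Function.uncurry Δ p := by
    filter_upwards [hΔnonpos] with p hp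
    exact neg_nonneg.2 hp
  have htotal : 0 ≤ ∫ p, Function.uncurry Δ p ∂((volume.restrict (Icc (0 : ℝ) T)).prod P) := by
    rw [integral_prod _ hΔi]
    exact integral_nonneg_of_ae hmean
  have hzero : ∫ p, -Function.uncurry Δ p ∂((volume.restrict (Icc (0 : ℝ) T)).prod P) = 0 := by
    refine le_antisymm ?_ (integral_nonneg_of_ae hneg)
    rw [integral_neg]
    exact neg_nonpos.2 htotal
  filter_upwards [(integral_eq_zero_iff_of_nonneg_ae hneg hΔi.neg).1 hzero] with p hp
  exact neg_eq_zero.1 hp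
end

section
/- Let T > 0 and let (Ω, 𝓕, (𝓕_t)_{t∈[0,T]}, P) be a filtered probability space. Let U ⊆ ℝ^k be a nonempty closed convex set, let g : [0,T] × Ω → ℝ^k be progressively measurable with E[∫₀^T |g_t| dt] < ∞, and let ū : [0,T] × Ω → U be progressively measurable with E[∫₀^T |ū_t|² dt] < ∞. Suppose that for every progressively measurable process u : [0,T] × Ω → U with E[∫₀^T |u_t|² dt] < ∞ one has E[∫₀^T ⟨g_t, (u_t − ū_t)/(|u_t − ū_t| ∨ 1)⟩ dt] ≥ 0. Then for (Lebesgue ⊗ P)-almost every (t,ω) ∈ [0,T] × Ω, one has ⟨g_t(ω), v − ū_t(ω)⟩ ≥ 0 for every v ∈ U. -/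
open MeasureTheory Set
open scoped RealInnerProductSpace

namespace MeasureTheory.IsStronglyProgressive

variable {Ω E : Type*} {m : MeasurableSpace Ω} {ℱ : Filtration ℝ m}

/-- A progressively measurable process is jointly measurable, up to null sets, on `[a, b] × Ω`. -/
theorem aestronglyMeasurable_prod [TopologicalSpace E] {X : ℝ → Ω → E}
    (hX : IsStronglyProgressive ℱ X) (a b : ℝ) (P : Measure Ω) [SFinite P] :
    AEStronglyMeasurable (fun p : ℝ × Ω ↦ X p.1 p.2)
      ((volume.restrict (Icc a b)).prod P) := by
  have hle : Subtype.instMeasurableSpace.prod (ℱ b) ≤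
      (Subtype.instMeasurableSpace.prod m : MeasurableSpace (Iic b × Ω)) :=
    sup_le_sup le_rfl (MeasurableSpace.comap_mono (ℱ.le b))
  have hmeas : StronglyMeasurable fun p : ℝ × Ω ↦ X (min p.1 b) p.2 :=
    ((hX b).mono hle).comp_measurable (g := fun p : ℝ × Ω ↦
        ((⟨min p.1 b, mem_Iic.2 (min_le_right _ _)⟩ : Iic b), p.2))
      (((measurable_fst.min measurable_const).subtype_mk).prodMk measurable_snd)
  refine ⟨_, hmeas, ?_⟩
  have hae : ∀ᵐ t ∂(volume.restrict (Icc a b)), t ∈ Icc a b := ae_restrict_mem measurableSet_Icc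
  filter_upwards [Measure.quasiMeasurePreserving_fst.ae hae] with p hp
  rw [min_eq_left hp.2]

/-- Two progressively measurable processes can be pasted along the set where a third,
real-valued one is negative. -/
theorem ite_neg [TopologicalSpace E] {X Y : ℝ → Ω → E} {Z : ℝ → Ω → ℝ}
    (hX : IsStronglyProgressive ℱ X) (hY : IsStronglyProgressive ℱ Y)
    (hZ : IsStronglyProgressive ℱ Z) :
    IsStronglyProgressive ℱ fun t ω ↦ if Z t ω < 0 then X t ω else Y t ω := fun i ↦
  StronglyMeasurable.ite ((hZ i).measurable measurableSet_Iio) (hX i) (hY i)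

/-- The inner product of progressively measurable processes is progressively measurable. -/
theorem inner [NormedAddCommGroup E] [InnerProductSpace ℝ E] {X Y : ℝ → Ω → E}
    (hX : IsStronglyProgressive ℱ X) (hY : IsStronglyProgressive ℱ Y) :
    IsStronglyProgressive ℱ fun t ω ↦ ⟪X t ω, Y t ω⟫ := fun i ↦
  continuous_inner.comp_stronglyMeasurable ((hX i).prodMk (hY i))

end MeasureTheory.IsStronglyProgressive

/-- Normalizing `w` by `max ‖w‖ 1` yields a vector of norm at most one. -/
theorem norm_inv_max_one_smul_le {E : Type*} [SeminormedAddCommGroup E] [NormedSpace ℝ E] (w : E) :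
    ‖(max ‖w‖ 1)⁻¹ • w‖ ≤ 1 := by
  have hpos : 0 < max ‖w‖ 1 := lt_max_of_lt_right one_pos
  rw [norm_smul, Real.norm_of_nonneg (inv_nonneg.2 hpos.le), inv_mul_le_iff₀ hpos, mul_one]
  exact le_max_left _ _

/-- Adding a constant preserves finiteness of an iterated integral over finite measures. -/
theorem lintegral_lintegral_const_add_lt_top {α β : Type*} [MeasurableSpace α] [MeasurableSpace β]
    {μ : Measure α} {ν : Measure β} [IsFiniteMeasure μ] [IsFiniteMeasure ν]
    {f : α → β → ENNReal} (hf : ∫⁻ y, ∫⁻ x, f x y ∂μ ∂ν < ⊤) {c : ENNReal} (hc : c ≠ ⊤) :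
    ∫⁻ y, ∫⁻ x, (c + f x y) ∂μ ∂ν < ⊤ := by
  simp_rw [lintegral_add_left measurable_const, lintegral_const]
  exact ENNReal.add_lt_top.2 ⟨ENNReal.mul_lt_top
    (ENNReal.mul_lt_top hc.lt_top (measure_lt_top _ _)) (measure_lt_top _ _), hf⟩

/-- If `0 ≤ f x v` holds almost everywhere for each `v` in a separable set, with `f x` continuous,
then almost everywhere it holds simultaneously for all `v` in that set. -/
theorem ae_forall_mem_nonneg_of_continuous {α E : Type*} [MeasurableSpace α] {μ : Measure α}
    [TopologicalSpace E] [TopologicalSpace.PseudoMetrizableSpace E] {U : Set E}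
    (hU : TopologicalSpace.IsSeparable U)
    {f : α → E → ℝ} (hf : ∀ x, Continuous (f x)) (h : ∀ v ∈ U, ∀ᵐ x ∂μ, 0 ≤ f x v) :
    ∀ᵐ x ∂μ, ∀ v ∈ U, 0 ≤ f x v := by
  obtain ⟨D, hDU, hDc, hUD⟩ := hU.exists_countable_dense_subset
  filter_upwards [(ae_ball_iff hDc).2 fun v hv ↦ h v (hDU hv)] with x hx v hv
  exact closure_minimal (t := {v | 0 ≤ f x v}) hx
    (isClosed_le continuous_const (hf x)) (hUD hv)

/-- Localization step of the stochastic maximum principle: from the integrated variational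
inequality over all admissible `U`-valued controls, the pointwise optimality condition
`⟨g_t, v − ū_t⟩ ≥ 0` for all `v ∈ U` holds (Lebesgue ⊗ P)-a.e. -/
theorem stmt9
    {Ω : Type*} {m : MeasurableSpace Ω} (P : Measure Ω) [IsProbabilityMeasure P]
    (T : ℝ) (hT : 0 < T) (ℱ : Filtration ℝ m) {k : ℕ}
    (U : Set (EuclideanSpace ℝ (Fin k))) (hUne : U.Nonempty) (hUclosed : IsClosed U)
    (hUconv : Convex ℝ U)
    (g : ℝ → Ω → EuclideanSpace ℝ (Fin k)) (hg : ProgMeasurable ℱ g)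
    (hgint : ∫⁻ ω, (∫⁻ t in Icc (0 : ℝ) T, ENNReal.ofReal ‖g t ω‖) ∂P < ⊤)
    (ubar : ℝ → Ω → EuclideanSpace ℝ (Fin k)) (hubar : ProgMeasurable ℱ ubar)
    (hubarU : ∀ t ω, ubar t ω ∈ U)
    (hubarint : ∫⁻ ω, (∫⁻ t in Icc (0 : ℝ) T, ENNReal.ofReal (‖ubar t ω‖ ^ 2)) ∂P < ⊤)
    (h : ∀ u : ℝ → Ω → EuclideanSpace ℝ (Fin k), ProgMeasurable ℱ u →
      (∀ t ω, u t ω ∈ U) →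
      (∫⁻ ω, (∫⁻ t in Icc (0 : ℝ) T, ENNReal.ofReal (‖u t ω‖ ^ 2)) ∂P < ⊤) →
      0 ≤ ∫ ω, (∫ t in Icc (0 : ℝ) T,
          ⟪g t ω, (max ‖u t ω - ubar t ω‖ 1)⁻¹ • (u t ω - ubar t ω)⟫) ∂P) :
    ∀ᵐ p ∂((volume.restrict (Icc (0 : ℝ) T)).prod P),
      ∀ v ∈ U, 0 ≤ ⟪g p.1 p.2, v - ubar p.1 p.2⟫ := by
  have hcont : ∀ p : ℝ × Ω, Continuous fun v ↦ ⟪g p.1 p.2, v - ubar p.1 p.2⟫ := fun p ↦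
    continuous_const.inner (continuous_id.sub continuous_const)
  refine ae_forall_mem_nonneg_of_continuous (.of_separableSpace U) hcont fun v hv ↦ ?_
  have hZ : IsStronglyProgressive ℱ fun t ω ↦ ⟪g t ω, v - ubar t ω⟫ :=
    hg.inner ((isStronglyProgressive_const ℱ v).sub hubar)
  let u : ℝ → Ω → EuclideanSpace ℝ (Fin k) :=
    fun t ω ↦ if ⟪g t ω, v - ubar t ω⟫ < 0 then v else ubar t ω
  have hu : IsStronglyProgressive ℱ u := (isStronglyProgressive_const ℱ v).ite_neg hubar hZ
  have huU : ∀ t ω, u t ω ∈ U := fun t ω ↦ by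
    dsimp only [u]
    split_ifs
    exacts [hv, hubarU t ω]
  have huint : ∫⁻ ω, (∫⁻ t in Icc (0 : ℝ) T, ENNReal.ofReal (‖u t ω‖ ^ 2)) ∂P < ⊤ := by
    refine lt_of_le_of_lt (lintegral_mono fun ω ↦ lintegral_mono fun t ↦ ?_)
      (lintegral_lintegral_const_add_lt_top hubarint
        (ENNReal.ofReal_ne_top (r := ‖v‖ ^ 2)))
    dsimp only [u]
    split_ifs
    exacts [le_self_add, le_add_self]
  let F : ℝ × Ω → ℝ := fun p ↦
    ⟪g p.1 p.2, (max ‖u p.1 p.2 - ubar p.1 p.2‖ 1)⁻¹ • (u p.1 p.2 - ubar p.1 p.2)⟫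
  have hgm := hg.aestronglyMeasurable_prod 0 T P
  have hg_integrable : Integrable (fun p : ℝ × Ω ↦ g p.1 p.2)
      ((volume.restrict (Icc (0 : ℝ) T)).prod P) := by
    refine ⟨hgm, (hasFiniteIntegral_iff_norm _).2 ?_⟩
    rwa [lintegral_prod_symm _ hgm.norm.aemeasurable.ennreal_ofReal]
  have hF : Integrable F ((volume.restrict (Icc (0 : ℝ) T)).prod P) := by
    have hw := (hu.aestronglyMeasurable_prod 0 T P).sub (hubar.aestronglyMeasurable_prod 0 T P)
    refine hg_integrable.norm.mono' (hgm.inner (AEStronglyMeasurable.smul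
      (hw.norm.aemeasurable.max aemeasurable_const).inv.aestronglyMeasurable hw))
      (.of_forall fun p ↦ ?_)
    exact (norm_inner_le_norm _ _).trans
      (mul_le_of_le_one_right (norm_nonneg _) (norm_inv_max_one_smul_le _))
  have hF_neg : ∀ p : ℝ × Ω, ⟪g p.1 p.2, v - ubar p.1 p.2⟫ < 0 → F p < 0 := fun p hp ↦ by
    simp only [F, u, if_pos hp, real_inner_smul_right]
    exact mul_neg_of_pos_of_neg (inv_pos.2 (lt_max_of_lt_right one_pos)) hp
  have hF_nonpos : ∀ p, F p ≤ 0 := fun p ↦ by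
    by_cases hp : ⟪g p.1 p.2, v - ubar p.1 p.2⟫ < 0
    · exact (hF_neg p hp).le
    · simp [F, u, if_neg hp]
  have hF_int : 0 ≤ ∫ p, F p ∂((volume.restrict (Icc (0 : ℝ) T)).prod P) := by
    rw [integral_prod_symm F hF]
    exact h u hu huU huint
  have hF_zero : (fun p ↦ -F p) =ᵐ[(volume.restrict (Icc (0 : ℝ) T)).prod P] 0 := by
    refine (integral_eq_zero_iff_of_nonneg (fun p ↦ neg_nonneg.2 (hF_nonpos p)) hF.neg).1 ?_
    rw [integral_neg, neg_eq_zero]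
    exact le_antisymm (integral_nonpos hF_nonpos) hF_int
  filter_upwards [hF_zero] with p hp
  by_contra! hlt
  exact (hF_neg p hlt).ne (neg_eq_zero.1 hp)
end
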